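/- Define E(T) ∈ ℚ[S_n] for complete binary trees T with n leaves recursively by: E(single leaf) = identity of S_1, and E(T1∧T2) = E(T1)↗E(T2) − E(T2)↙E(T1), where T1∧T2 is the tree with left subtree T1 and right subtree T2. Then for every complete binary tree T with n leaves, E(T) = Σ_{σ admissible for T} T(σ), the sum of the evaluations of T over all admissible labellings of its leaves. -/

import Mathlib

/-- The free module on words of positive integers, with coefficients in `R`.
`ℚ[S_n]` is identified with the span of the permutation words of {1,…,n}. -/
abbrev FW (R : Type) [CommRing R] := (List ℕ) →₀ R

variable {R : Type} [CommRing R]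

/-- Concatenation product, extended bilinearly. -/
noncomputable def catW (x y : FW R) : FW R :=
  x.sum fun u a => y.sum fun v b => Finsupp.single (u ++ v) (a * b)

/-- The bracket [x,y] = x·y − y·x of the concatenation product. -/
noncomputable def brakW (x y : FW R) : FW R := catW x y - catW y x

/-- (Incomplete) binary trees; `nil` is the empty tree. The complete binary tree with
`t.nodes + 1` leaves whose internal nodes form `t` is implicit in the definitions below. -/
inductive BT
  | nil : BT
  | nd : BT → BT → BT
deriving DecidableEq

/-- Number of nodes of a binary tree. -/
def BT.nodes : BT → ℕ
  | .nil => 0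
  | .nd l r => l.nodes + r.nodes + 1

/-- The evaluation T(σ) of the complete binary tree `T` whose internal nodes form `t`, with
leaves labelled left to right by the word `w`: each leaf gets the one-letter word of its label
and each internal node the bracket of concatenation. -/
noncomputable def evalBT : BT → List ℕ → FW R
  | .nil, w => Finsupp.single w 1
  | .nd l r, w => brakW (evalBT l (w.take (l.nodes + 1))) (evalBT r (w.drop (l.nodes + 1)))

/-- The standardization of a word with distinct letters: each letter is replaced by its rank. -/
def stdW (w : List ℕ) : List ℕ := w.map fun x => (w.filter (· ≤ x)).length

/-- The set of permutation words of {1, …, n}. -/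
def permWords (n : ℕ) : Finset (List ℕ) := (List.range' 1 n).permutations.toFinset

/-- Convolution α⋆β of two permutation words: the sum of all permutation words γ of size
|α|+|β| with std(γ(1)⋯γ(m)) = α and std(γ(m+1)⋯γ(m+n)) = β. -/
noncomputable def convW (u v : List ℕ) : FW R :=
  ∑ γ ∈ (permWords (u.length + v.length)).filter
      (fun γ => stdW (γ.take u.length) = u ∧ stdW (γ.drop u.length) = v),
    Finsupp.single γ 1

/-- The convolution product, extended bilinearly. -/
noncomputable def starW (x y : FW R) : FW R :=
  x.sum fun u a => y.sum fun v b => (a * b) • convW u v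

/-- Whether the word `w` is an admissible labelling of (the completion of) `t`: at each internal
node, the smallest label lies in the left subtree and the largest in the right subtree. -/
def admB : BT → List ℕ → Bool
  | .nil, _ => true
  | .nd l r, w =>
    admB l (w.take (l.nodes + 1)) && admB r (w.drop (l.nodes + 1))
      && decide ((w.take (l.nodes + 1)).minimum = w.minimum)
      && decide ((w.drop (l.nodes + 1)).maximum = w.maximum)

/-- c_t: the sum of the evaluations T(σ) over all admissible labellings σ of the complete
binary tree whose internal nodes form `t`. -/
noncomputable def cElt (t : BT) : FW R :=
  ∑ w ∈ (permWords (t.nodes + 1)).filter (fun w => admB t w = true), evalBT t w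


/-- Word-level half product α↗β: the sum of all permutation words γ of size m+n = |α|+|β| with
std(γ(1)⋯γ(m)) = α, std(γ(m+1)⋯γ(m+n)) = β, the letter 1 among the first m letters of γ and
the letter m+n among the last n letters. -/
noncomputable def neW (u v : List ℕ) : FW R :=
  ∑ γ ∈ (permWords (u.length + v.length)).filter
      (fun γ => stdW (γ.take u.length) = u ∧ stdW (γ.drop u.length) = v
        ∧ 1 ∈ γ.take u.length ∧ (u.length + v.length) ∈ γ.drop u.length),
    Finsupp.single γ 1

/-- Word-level half product α↙β: as for ↗ but with the letter 1 among the last n letters and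
the letter m+n among the first m letters. -/
noncomputable def swW (u v : List ℕ) : FW R :=
  ∑ γ ∈ (permWords (u.length + v.length)).filter
      (fun γ => stdW (γ.take u.length) = u ∧ stdW (γ.drop u.length) = v
        ∧ 1 ∈ γ.drop u.length ∧ (u.length + v.length) ∈ γ.take u.length),
    Finsupp.single γ 1

/-- α↗β extended bilinearly. -/
noncomputable def neExt (x y : FW R) : FW R :=
  x.sum fun u a => y.sum fun v b => (a * b) • neW u v

/-- α↙β extended bilinearly. -/
noncomputable def swExt (x y : FW R) : FW R :=
  x.sum fun u a => y.sum fun v b => (a * b) • swW u v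

/-- E(T), defined recursively by E(leaf) = 1 ∈ ℚ[S_1] and E(T1∧T2) = E(T1)↗E(T2) − E(T2)↙E(T1),
with trees encoded by their internal nodes. -/
noncomputable def EBT : BT → FW ℚ
  | .nil => Finsupp.single [1] 1
  | .nd l r => neExt (EBT l) (EBT r) - swExt (EBT r) (EBT l)

/-- The strictly increasing map sending `0` to `0` and `k ∈ {1, …, |A|}` to the `k`-th smallest
element of a set `A` of positive integers. -/
noncomputable def relabel (A : Finset ℕ) (k : ℕ) : ℕ :=
  Nat.nth (fun x => x = 0 ∨ x ∈ A ∨ A.sup id < x) k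

theorem infinite_setOf_relabel (A : Finset ℕ) :
    {x | x = 0 ∨ x ∈ A ∨ A.sup id < x}.Infinite :=
  (Set.Ioi_infinite (A.sup id)).mono fun _ hx => Or.inr (Or.inr hx)

theorem relabel_strictMono (A : Finset ℕ) : StrictMono (relabel A) :=
  Nat.nth_strictMono (infinite_setOf_relabel A)

theorem count_eq_card_filter_le (A : Finset ℕ) (h0 : 0 ∉ A) {x : ℕ} (hx : x ∈ A) :
    Nat.count (fun x => x = 0 ∨ x ∈ A ∨ A.sup id < x) x = (A.filter (· ≤ x)).card := by
  have hpos : 0 < x := Nat.pos_of_ne_zero fun h => h0 (h ▸ hx)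
  have hle : x ≤ A.sup id := Finset.le_sup (f := id) hx
  have e1 : (Finset.range x).filter (fun x => x = 0 ∨ x ∈ A ∨ A.sup id < x)
      = insert 0 (A.filter (· < x)) := by
    ext y
    simp only [Finset.mem_filter, Finset.mem_range, Finset.mem_insert]
    constructor
    · rintro ⟨h, rfl | h' | h'⟩ <;> [exact Or.inl rfl; exact Or.inr ⟨h', h⟩; omega]
    · rintro (rfl | ⟨h, h'⟩) <;> [exact ⟨hpos, Or.inl rfl⟩; exact ⟨h', Or.inr (Or.inl h)⟩]
  have e2 : A.filter (· ≤ x) = insert x (A.filter (· < x)) := by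
    ext y
    simp only [Finset.mem_filter, Finset.mem_insert]
    constructor
    · rintro ⟨h, h'⟩
      rcases h'.eq_or_lt with h' | h' <;> [exact Or.inl h'; exact Or.inr ⟨h, h'⟩]
    · rintro (rfl | ⟨h, h'⟩) <;> [exact ⟨hx, le_rfl⟩; exact ⟨h, h'.le⟩]
  rw [Nat.count_eq_card_filter_range, e1, e2, Finset.card_insert_of_notMem (by simp [h0]),
    Finset.card_insert_of_notMem (by simp)]

theorem relabel_card_filter_le (A : Finset ℕ) (h0 : 0 ∉ A) {x : ℕ} (hx : x ∈ A) :
    relabel A (A.filter (· ≤ x)).card = x := by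
  rw [← count_eq_card_filter_le A h0 hx]
  exact Nat.nth_count (p := fun x => x = 0 ∨ x ∈ A ∨ A.sup id < x) (Or.inr (Or.inl hx))

theorem relabel_mem (A : Finset ℕ) (h0 : 0 ∉ A) {k : ℕ} (hk : 1 ≤ k) (hk' : k ≤ A.card) :
    relabel A k ∈ A := by
  have hsurj : Finset.image (relabel A) (Finset.image (fun x => (A.filter (· ≤ x)).card) A) = A := by
    rw [Finset.image_image]
    refine (Finset.image_congr fun x hx => ?_).trans Finset.image_id
    exact relabel_card_filter_le A h0 hx
  have hsub : Finset.image (fun x => (A.filter (· ≤ x)).card) A ⊆ Finset.Icc 1 A.card := by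
    intro y hy
    obtain ⟨x, hx, rfl⟩ := Finset.mem_image.1 hy
    exact Finset.mem_Icc.2 ⟨Finset.card_pos.2 ⟨x, by simp [hx]⟩, Finset.card_filter_le _ _⟩
  have heq := Finset.eq_of_subset_of_card_le hsub (by
    have h := Finset.card_image_le (s := Finset.image (fun x => (A.filter (· ≤ x)).card) A)
      (f := relabel A)
    rw [hsurj] at h
    simpa using h)
  rw [heq] at hsurj
  have := Finset.mem_image_of_mem (relabel A) (Finset.mem_Icc.2 ⟨hk, hk'⟩)
  rwa [hsurj] at this

theorem mem_permWords {n : ℕ} {w : List ℕ} :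
    w ∈ permWords n ↔ w.Nodup ∧ w.toFinset = Finset.Icc 1 n := by
  have hr : (List.range' 1 n).toFinset = Finset.Icc 1 n := by
    ext x
    simp only [List.mem_toFinset, List.mem_range'_1, Finset.mem_Icc]
    omega
  rw [permWords, List.mem_toFinset, List.mem_permutations]
  constructor
  · intro h
    exact ⟨h.nodup_iff.2 List.nodup_range', by rw [← hr]; exact List.toFinset_eq_of_perm _ _ h⟩
  · rintro ⟨h, h'⟩
    exact List.perm_of_nodup_nodup_toFinset_eq h List.nodup_range' (h'.trans hr.symm)

theorem length_of_mem_permWords {n : ℕ} {w : List ℕ} (h : w ∈ permWords n) : w.length = n := by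
  obtain ⟨h, h'⟩ := mem_permWords.1 h
  rw [← List.toFinset_card_of_nodup h, h', Nat.card_Icc, Nat.add_sub_cancel]

theorem length_filter_le {w : List ℕ} (h : w.Nodup) (x : ℕ) :
    (w.filter (· ≤ x)).length = (w.toFinset.filter (· ≤ x)).card := by
  rw [← List.toFinset_card_of_nodup (h.filter _), List.toFinset_filter]
  simp

theorem stdW_of_mem_permWords {n : ℕ} {w : List ℕ} (h : w ∈ permWords n) : stdW w = w := by
  obtain ⟨h, h'⟩ := mem_permWords.1 h
  refine (List.map_congr_left fun x hx => ?_).trans (List.map_id w)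
  have hx : x ∈ Finset.Icc 1 n := by rw [← h']; exact List.mem_toFinset.2 hx
  rw [length_filter_le h, h']
  have : (Finset.Icc 1 n).filter (· ≤ x) = Finset.Icc 1 x := by
    ext y
    simp only [Finset.mem_filter, Finset.mem_Icc] at hx ⊢
    omega
  simp [this]

theorem stdW_map {f : ℕ → ℕ} (hf : StrictMono f) (w : List ℕ) : stdW (w.map f) = stdW w := by
  simp [stdW, List.filter_map, Function.comp_def, hf.le_iff_le]

theorem map_relabel_stdW {w : List ℕ} (h : w.Nodup) (h0 : 0 ∉ w.toFinset) :
    (stdW w).map (relabel w.toFinset) = w := by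
  rw [stdW, List.map_map]
  refine (List.map_congr_left fun x hx => ?_).trans (List.map_id w)
  simp only [Function.comp_apply, length_filter_le h]
  exact relabel_card_filter_le _ h0 (List.mem_toFinset.2 hx)

theorem stdW_mem_permWords {w : List ℕ} (h : w.Nodup) (h0 : 0 ∉ w.toFinset) :
    stdW w ∈ permWords w.length := by
  have hn : (stdW w).Nodup := List.Nodup.of_map (relabel w.toFinset)
    (by rwa [map_relabel_stdW h h0])
  refine mem_permWords.2 ⟨hn, Finset.eq_of_subset_of_card_le ?_ ?_⟩
  · intro y hy
    obtain ⟨x, hx, rfl⟩ := List.mem_map.1 (List.mem_toFinset.1 hy)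
    exact Finset.mem_Icc.2
      ⟨List.length_pos_of_mem (List.mem_filter.2 ⟨hx, by simp⟩), List.length_filter_le _ _⟩
  · rw [List.toFinset_card_of_nodup hn]
    simp [stdW]

theorem nodup_map_relabel {A : Finset ℕ} {w : List ℕ} (h : w ∈ permWords A.card) :
    (w.map (relabel A)).Nodup :=
  (mem_permWords.1 h).1.map (relabel_strictMono A).injective

theorem toFinset_map_relabel {A : Finset ℕ} (h0 : 0 ∉ A) {w : List ℕ}
    (h : w ∈ permWords A.card) : (w.map (relabel A)).toFinset = A := by
  refine Finset.eq_of_subset_of_card_le ?_ ?_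
  · intro y hy
    obtain ⟨x, hx, rfl⟩ := List.mem_map.1 (List.mem_toFinset.1 hy)
    have hx : x ∈ Finset.Icc 1 A.card := by
      rw [← (mem_permWords.1 h).2]; exact List.mem_toFinset.2 hx
    exact relabel_mem A h0 (Finset.mem_Icc.1 hx).1 (Finset.mem_Icc.1 hx).2
  · rw [List.toFinset_card_of_nodup (nodup_map_relabel h), List.length_map,
      length_of_mem_permWords h]

/-- The word whose first letters form a relabelling of `u` by `A` and whose last letters form a
relabelling of `v` by the complement of `A` in `{1, …, N}`. -/
noncomputable def glue (N : ℕ) (A : Finset ℕ) (u v : List ℕ) : List ℕ :=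
  u.map (relabel A) ++ v.map (relabel (Finset.Icc 1 N \ A))

section glue

variable {m n : ℕ} {A : Finset ℕ} {u v : List ℕ}

theorem zero_notMem_of_mem_powersetCard
    (hA : A ∈ Finset.powersetCard m (Finset.Icc 1 (m + n))) : 0 ∉ A := fun h => by
  simpa using (Finset.mem_powersetCard.1 hA).1 h

theorem sdiff_mem_powersetCard
    (hA : A ∈ Finset.powersetCard m (Finset.Icc 1 (m + n))) :
    Finset.Icc 1 (m + n) \ A ∈ Finset.powersetCard n (Finset.Icc 1 (n + m)) := by
  obtain ⟨h, h'⟩ := Finset.mem_powersetCard.1 hA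
  refine Finset.mem_powersetCard.2 ⟨?_, ?_⟩
  · rw [add_comm n m]; exact Finset.sdiff_subset
  · rw [Finset.card_sdiff_of_subset h, h', Nat.card_Icc]; omega

theorem toFinset_map_relabel_left (hA : A ∈ Finset.powersetCard m (Finset.Icc 1 (m + n)))
    (hu : u ∈ permWords m) : (u.map (relabel A)).toFinset = A :=
  toFinset_map_relabel (zero_notMem_of_mem_powersetCard hA)
    (by rwa [(Finset.mem_powersetCard.1 hA).2])

theorem take_glue (hu : u ∈ permWords m) (N : ℕ) :
    (glue N A u v).take m = u.map (relabel A) := by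
  rw [glue, List.take_left' (by rw [List.length_map, length_of_mem_permWords hu])]

theorem drop_glue (hu : u ∈ permWords m) (N : ℕ) :
    (glue N A u v).drop m = v.map (relabel (Finset.Icc 1 N \ A)) := by
  rw [glue, List.drop_left' (by rw [List.length_map, length_of_mem_permWords hu])]

theorem glue_mem_permWords (hA : A ∈ Finset.powersetCard m (Finset.Icc 1 (m + n)))
    (hu : u ∈ permWords m) (hv : v ∈ permWords n) : glue (m + n) A u v ∈ permWords (m + n) := by
  have h1 := toFinset_map_relabel_left hA hu
  have h2 := toFinset_map_relabel_left (sdiff_mem_powersetCard hA) hv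
  refine mem_permWords.2 ⟨?_, ?_⟩
  · refine List.Nodup.append (nodup_map_relabel (by rwa [(Finset.mem_powersetCard.1 hA).2]))
      (nodup_map_relabel
        (by rwa [(Finset.mem_powersetCard.1 (sdiff_mem_powersetCard hA)).2])) ?_
    rw [← List.disjoint_toFinset_iff_disjoint, h1, h2]
    exact Finset.disjoint_sdiff
  · rw [glue, List.toFinset_append, h1, h2]
    exact Finset.union_sdiff_of_subset (Finset.mem_powersetCard.1 hA).1

theorem sum_permWords_add {M : Type*} [AddCommMonoid M] (m n : ℕ) (F : List ℕ → M) :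
    ∑ γ ∈ permWords (m + n), F γ =
      ∑ A ∈ Finset.powersetCard m (Finset.Icc 1 (m + n)),
        ∑ u ∈ permWords m, ∑ v ∈ permWords n, F (glue (m + n) A u v) := by
  simp_rw [← Finset.sum_product']
  symm
  refine Finset.sum_nbij' (fun p => glue (m + n) p.1 p.2.1 p.2.2)
    (fun γ => ((γ.take m).toFinset, stdW (γ.take m), stdW (γ.drop m))) ?_ ?_ ?_ ?_ ?_
  · rintro ⟨A, u, v⟩ h
    simp only [Finset.mem_product] at h
    exact glue_mem_permWords h.1 h.2.1 h.2.2
  · intro γ h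
    have hl := length_of_mem_permWords h
    obtain ⟨h, h'⟩ := mem_permWords.1 h
    have h0 : 0 ∉ γ := fun h0 => by
      have := List.mem_toFinset.2 h0
      simp [h'] at this
    have hl1 : (γ.take m).length = m := by simp [hl]
    have hl2 : (γ.drop m).length = n := by simp [hl]
    have ht : (γ.take m).Nodup := h.sublist (List.take_sublist _ _)
    have hd : (γ.drop m).Nodup := h.sublist (List.drop_sublist _ _)
    refine Finset.mem_product.2 ⟨Finset.mem_powersetCard.2 ⟨?_, ?_⟩, Finset.mem_product.2 ⟨?_, ?_⟩⟩
    · intro x hx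
      rw [← h']
      exact List.mem_toFinset.2 (List.mem_of_mem_take (List.mem_toFinset.1 hx))
    · rw [List.toFinset_card_of_nodup ht, hl1]
    · simpa only [hl1] using stdW_mem_permWords ht
        fun hx => h0 (List.mem_of_mem_take (List.mem_toFinset.1 hx))
    · simpa only [hl2] using stdW_mem_permWords hd
        fun hx => h0 (List.mem_of_mem_drop (List.mem_toFinset.1 hx))
  · rintro ⟨A, u, v⟩ h
    simp only [Finset.mem_product] at h
    obtain ⟨hA, hu, hv⟩ := h
    simp only [take_glue hu, drop_glue hu, toFinset_map_relabel_left hA hu,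
      stdW_map (relabel_strictMono _), stdW_of_mem_permWords hu, stdW_of_mem_permWords hv]
  · intro γ hγ
    obtain ⟨h, h'⟩ := mem_permWords.1 hγ
    have h0 : 0 ∉ γ := fun h0 => by
      have := List.mem_toFinset.2 h0
      simp [h'] at this
    have ht : (γ.take m).Nodup := h.sublist (List.take_sublist _ _)
    have hd : (γ.drop m).Nodup := h.sublist (List.drop_sublist _ _)
    have hc : Finset.Icc 1 (m + n) \ (γ.take m).toFinset = (γ.drop m).toFinset := by
      rw [← h']
      conv_lhs => rw [← List.take_append_drop m γ]
      rw [List.toFinset_append, List.take_left' (by simp [length_of_mem_permWords hγ]),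
        Finset.union_sdiff_cancel_left]
      rw [List.disjoint_toFinset_iff_disjoint]
      exact List.disjoint_take_drop h le_rfl
    simp only [glue, hc]
    rw [map_relabel_stdW ht fun hx => h0 (List.mem_of_mem_take (List.mem_toFinset.1 hx)),
      map_relabel_stdW hd fun hx => h0 (List.mem_of_mem_drop (List.mem_toFinset.1 hx)),
      List.take_append_drop]
  · simp

/-- The subsets of `{1, …, m + n}` of size `m` containing `1` but not `m + n`. -/
def splitSets (m n : ℕ) : Finset (Finset ℕ) :=
  (Finset.powersetCard m (Finset.Icc 1 (m + n))).filter fun A => 1 ∈ A ∧ m + n ∉ A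

theorem mem_map_relabel_left (hA : A ∈ Finset.powersetCard m (Finset.Icc 1 (m + n)))
    (hu : u ∈ permWords m) {x : ℕ} : x ∈ u.map (relabel A) ↔ x ∈ A := by
  rw [← List.mem_toFinset, toFinset_map_relabel_left hA hu]

theorem mem_map_relabel_right (hA : A ∈ Finset.powersetCard m (Finset.Icc 1 (m + n)))
    (hv : v ∈ permWords n) {x : ℕ} :
    x ∈ v.map (relabel (Finset.Icc 1 (m + n) \ A)) ↔ (1 ≤ x ∧ x ≤ m + n) ∧ x ∉ A := by
  rw [mem_map_relabel_left (sdiff_mem_powersetCard hA) hv, Finset.mem_sdiff, Finset.mem_Icc]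

theorem neW_eq_sum (hu : u ∈ permWords m) (hv : v ∈ permWords n) (hn : 0 < n) :
    neW (R := R) u v = ∑ A ∈ splitSets m n, Finsupp.single (glue (m + n) A u v) 1 := by
  rw [neW, length_of_mem_permWords hu, length_of_mem_permWords hv, Finset.sum_filter,
    sum_permWords_add, splitSets, Finset.sum_filter]
  refine Finset.sum_congr rfl fun A hA => ?_
  rw [Finset.sum_eq_single_of_mem u hu, Finset.sum_eq_single_of_mem v hv]
  · simp only [take_glue hu, drop_glue hu, mem_map_relabel_left hA hu, mem_map_relabel_right hA hv]
    have h1 : 1 ≤ m + n := by omega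
    simp [stdW_map (relabel_strictMono _), stdW_of_mem_permWords hu, stdW_of_mem_permWords hv, h1]
  · intro v' hv' hne
    rw [drop_glue hu]
    simp [stdW_map (relabel_strictMono _), stdW_of_mem_permWords hv', hne]
  · intro u' hu' hne
    refine Finset.sum_eq_zero fun v' hv' => ?_
    rw [take_glue hu']
    simp [stdW_map (relabel_strictMono _), stdW_of_mem_permWords hu', hne]

theorem swW_eq_sum (hu : u ∈ permWords m) (hv : v ∈ permWords n) (hn : 0 < n) :
    swW (R := R) v u = ∑ A ∈ splitSets m n, Finsupp.single
      (v.map (relabel (Finset.Icc 1 (m + n) \ A)) ++ u.map (relabel A)) 1 := by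
  rw [swW, length_of_mem_permWords hu, length_of_mem_permWords hv, Finset.sum_filter,
    sum_permWords_add, splitSets, Finset.sum_filter]
  have hss : ∀ {k l : ℕ} {B : Finset ℕ}, B ∈ Finset.powersetCard k (Finset.Icc 1 (k + l)) →
      Finset.Icc 1 (l + k) \ (Finset.Icc 1 (k + l) \ B) = B := fun {k l B} hB => by
    rw [add_comm l k, Finset.sdiff_sdiff_eq_self (Finset.mem_powersetCard.1 hB).1]
  refine Finset.sum_nbij' (fun B => Finset.Icc 1 (n + m) \ B) (fun A => Finset.Icc 1 (m + n) \ A)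
    (fun _ => sdiff_mem_powersetCard) (fun _ => sdiff_mem_powersetCard)
    (fun _ => hss) (fun _ => hss) fun B hB => ?_
  rw [Finset.sum_eq_single_of_mem v hv, Finset.sum_eq_single_of_mem u hu]
  · simp only [take_glue hv, drop_glue hv, mem_map_relabel_left hB hv, mem_map_relabel_right hB hu]
    have h1 : 1 ≤ n + m := by omega
    rw [hss hB]
    simp [stdW_map (relabel_strictMono _), stdW_of_mem_permWords hu, stdW_of_mem_permWords hv, h1,
      glue, add_comm m n]
  · intro u' hu' hne
    rw [drop_glue hv]
    simp [stdW_map (relabel_strictMono _), stdW_of_mem_permWords hu', hne]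
  · intro v' hv' hne
    refine Finset.sum_eq_zero fun u' hu' => ?_
    rw [take_glue hv']
    simp [stdW_map (relabel_strictMono _), stdW_of_mem_permWords hv', hne]

end glue

theorem minimum_map {f : ℕ → ℕ} (hf : StrictMono f) (w : List ℕ) :
    (w.map f).minimum = WithTop.map f w.minimum := by
  induction w with
  | nil => rfl
  | cons a w ih =>
    rw [List.map_cons, List.minimum_cons, List.minimum_cons, ih,
      (hf.monotone.withTop_map).map_min, WithTop.map_coe]

theorem maximum_map {f : ℕ → ℕ} (hf : StrictMono f) (w : List ℕ) :
    (w.map f).maximum = WithBot.map f w.maximum := by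
  induction w with
  | nil => rfl
  | cons a w ih =>
    rw [List.map_cons, List.maximum_cons, List.maximum_cons, ih,
      (hf.monotone.withBot_map).map_max, WithBot.map_coe]

theorem admB_map {f : ℕ → ℕ} (hf : StrictMono f) (t : BT) (w : List ℕ) :
    admB t (w.map f) = admB t w := by
  induction t generalizing w with
  | nil => rfl
  | nd l r ihl ihr =>
    simp only [admB, ← List.map_take, ← List.map_drop, ihl, ihr, minimum_map hf, maximum_map hf,
      (WithTop.map_injective hf.injective).eq_iff, (WithBot.map_injective hf.injective).eq_iff]

theorem catW_mapDomain (f g : ℕ → ℕ) (x y : FW R) :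
    catW (x.mapDomain (List.map f)) (y.mapDomain (List.map g)) =
      x.sum fun u a => y.sum fun v b => Finsupp.single (u.map f ++ v.map g) (a * b) := by
  rw [catW, Finsupp.sum_mapDomain_index (by simp) fun u a b => by
    simp [add_mul, Finsupp.sum_add]]
  refine Finsupp.sum_congr fun u _ => ?_
  rw [Finsupp.sum_mapDomain_index (by simp) fun v a b => by simp [mul_add]]

theorem mapDomain_catW (f : ℕ → ℕ) (x y : FW R) :
    (catW x y).mapDomain (List.map f) =
      catW (x.mapDomain (List.map f)) (y.mapDomain (List.map f)) := by
  rw [catW_mapDomain, catW, Finsupp.mapDomain_sum]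
  refine Finsupp.sum_congr fun u _ => ?_
  rw [Finsupp.mapDomain_sum]
  refine Finsupp.sum_congr fun v _ => ?_
  rw [Finsupp.mapDomain_single, List.map_append]

theorem evalBT_map (f : ℕ → ℕ) (t : BT) (w : List ℕ) :
    evalBT (R := R) t (w.map f) = (evalBT t w).mapDomain (List.map f) := by
  induction t generalizing w with
  | nil => simp [evalBT]
  | nd l r ihl ihr =>
    simp only [evalBT, brakW, ← List.map_take, ← List.map_drop, ihl, ihr, ← mapDomain_catW]
    exact (map_sub (Finsupp.mapDomain.addMonoidHom (List.map f) : FW R →+ FW R) _ _).symm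

theorem catW_sum {ι κ : Type*} (s : Finset ι) (t : Finset κ) (x : ι → FW R) (y : κ → FW R) :
    catW (∑ i ∈ s, x i) (∑ j ∈ t, y j) = ∑ i ∈ s, ∑ j ∈ t, catW (x i) (y j) := by
  simp only [catW]
  rw [← Finsupp.sum_finsetSum_index (by simp) fun u a b => by simp [add_mul, Finsupp.sum_add]]
  refine Finset.sum_congr rfl fun i _ => ?_
  rw [← Finsupp.sum_finsetSum_comm]
  refine Finsupp.sum_congr fun u _ => ?_
  rw [← Finsupp.sum_finsetSum_index (by simp) fun v a b => by simp [mul_add]]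

theorem brakW_sum {ι κ : Type*} (s : Finset ι) (t : Finset κ) (x : ι → FW R) (y : κ → FW R) :
    brakW (∑ i ∈ s, x i) (∑ j ∈ t, y j) = ∑ i ∈ s, ∑ j ∈ t, brakW (x i) (y j) := by
  simp only [brakW, catW_sum, Finset.sum_sub_distrib]
  rw [Finset.sum_comm (s := t)]

section halfProducts

variable {m n : ℕ} {x y : FW R}

theorem neExt_eq_sum (hx : x ∈ Finsupp.supported R R (permWords m : Set (List ℕ)))
    (hy : y ∈ Finsupp.supported R R (permWords n : Set (List ℕ))) (hn : 0 < n) :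
    neExt x y = ∑ A ∈ splitSets m n, catW (x.mapDomain (List.map (relabel A)))
      (y.mapDomain (List.map (relabel (Finset.Icc 1 (m + n) \ A)))) := by
  simp only [catW_mapDomain, Finsupp.sum, neExt]
  conv_rhs => rw [Finset.sum_comm]
  refine Finset.sum_congr rfl fun u hu => ?_
  conv_rhs => rw [Finset.sum_comm]
  refine Finset.sum_congr rfl fun v hv => ?_
  rw [neW_eq_sum (hx hu) (hy hv) hn, Finset.smul_sum]
  simp [glue]

theorem swExt_eq_sum (hx : x ∈ Finsupp.supported R R (permWords m : Set (List ℕ)))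
    (hy : y ∈ Finsupp.supported R R (permWords n : Set (List ℕ))) (hn : 0 < n) :
    swExt y x = ∑ A ∈ splitSets m n,
      catW (y.mapDomain (List.map (relabel (Finset.Icc 1 (m + n) \ A))))
        (x.mapDomain (List.map (relabel A))) := by
  simp only [catW_mapDomain, Finsupp.sum, swExt]
  conv_rhs => rw [Finset.sum_comm]
  refine Finset.sum_congr rfl fun v hv => ?_
  conv_rhs => rw [Finset.sum_comm]
  refine Finset.sum_congr rfl fun u hu => ?_
  rw [swW_eq_sum (hx hu) (hy hv) hn, Finset.smul_sum]
  simp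

theorem neExt_mem_supported (hx : x ∈ Finsupp.supported R R (permWords m : Set (List ℕ)))
    (hy : y ∈ Finsupp.supported R R (permWords n : Set (List ℕ))) :
    neExt x y ∈ Finsupp.supported R R (permWords (m + n) : Set (List ℕ)) := by
  refine Submodule.sum_mem _ fun u hu => Submodule.sum_mem _ fun v hv =>
    Submodule.smul_mem _ _ (Submodule.sum_mem _ fun γ hγ => Finsupp.single_mem_supported _ _ ?_)
  rw [length_of_mem_permWords (hx hu), length_of_mem_permWords (hy hv)] at hγ
  exact (Finset.mem_filter.1 hγ).1

theorem swExt_mem_supported (hx : x ∈ Finsupp.supported R R (permWords m : Set (List ℕ)))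
    (hy : y ∈ Finsupp.supported R R (permWords n : Set (List ℕ))) :
    swExt x y ∈ Finsupp.supported R R (permWords (m + n) : Set (List ℕ)) := by
  refine Submodule.sum_mem _ fun u hu => Submodule.sum_mem _ fun v hv =>
    Submodule.smul_mem _ _ (Submodule.sum_mem _ fun γ hγ => Finsupp.single_mem_supported _ _ ?_)
  rw [length_of_mem_permWords (hx hu), length_of_mem_permWords (hy hv)] at hγ
  exact (Finset.mem_filter.1 hγ).1

end halfProducts

theorem permWords_one : permWords 1 = {[1]} := by
  ext w
  simp [permWords]

theorem nodes_nd_add_one (l r : BT) :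
    (BT.nd l r).nodes + 1 = (l.nodes + 1) + (r.nodes + 1) := by
  rw [BT.nodes]
  omega

theorem EBT_mem_supported (t : BT) :
    EBT t ∈ Finsupp.supported ℚ ℚ (permWords (t.nodes + 1) : Set (List ℕ)) := by
  induction t with
  | nil => exact Finsupp.single_mem_supported _ _ (by simp [BT.nodes, permWords_one])
  | nd l r ihl ihr =>
    rw [nodes_nd_add_one]
    refine Submodule.sub_mem _ (neExt_mem_supported ihl ihr) ?_
    rw [add_comm]
    exact swExt_mem_supported ihr ihl

theorem minimum_of_mem_permWords {n : ℕ} {w : List ℕ} (h : w ∈ permWords n) (hn : 0 < n) :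
    w.minimum = WithTop.some 1 := by
  have hw : ∀ x, x ∈ w ↔ 1 ≤ x ∧ x ≤ n := fun x => by
    rw [← List.mem_toFinset, (mem_permWords.1 h).2, Finset.mem_Icc]
  exact List.minimum_eq_coe_iff.2 ⟨(hw 1).2 ⟨le_rfl, hn⟩, fun a ha => ((hw a).1 ha).1⟩

theorem maximum_of_mem_permWords {n : ℕ} {w : List ℕ} (h : w ∈ permWords n) (hn : 0 < n) :
    w.maximum = WithBot.some n := by
  have hw : ∀ x, x ∈ w ↔ 1 ≤ x ∧ x ≤ n := fun x => by
    rw [← List.mem_toFinset, (mem_permWords.1 h).2, Finset.mem_Icc]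
  exact List.maximum_eq_coe_iff.2 ⟨(hw n).2 ⟨hn, le_rfl⟩, fun a ha => ((hw a).1 ha).2⟩

theorem admB_nd_glue {l r : BT} {A : Finset ℕ} {u v : List ℕ}
    (hA : A ∈ Finset.powersetCard (l.nodes + 1)
      (Finset.Icc 1 ((l.nodes + 1) + (r.nodes + 1))))
    (hu : u ∈ permWords (l.nodes + 1)) (hv : v ∈ permWords (r.nodes + 1)) :
    admB (.nd l r) (glue ((l.nodes + 1) + (r.nodes + 1)) A u v) = true ↔
      (1 ∈ A ∧ (l.nodes + 1) + (r.nodes + 1) ∉ A) ∧ admB l u = true ∧ admB r v = true := by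
  have hpos : 0 < (l.nodes + 1) + (r.nodes + 1) := by omega
  have hg := glue_mem_permWords hA hu hv
  have hw : ∀ x ∈ glue ((l.nodes + 1) + (r.nodes + 1)) A u v,
      1 ≤ x ∧ x ≤ (l.nodes + 1) + (r.nodes + 1) := fun x hx => by
    rwa [← List.mem_toFinset, (mem_permWords.1 hg).2, Finset.mem_Icc] at hx
  have hmin : (u.map (relabel A)).minimum = WithTop.some 1 ↔ 1 ∈ A := by
    rw [List.minimum_eq_coe_iff, mem_map_relabel_left hA hu, and_iff_left]
    exact fun a ha => (hw a (List.mem_append_left _ ha)).1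
  have hmax : (v.map (relabel (Finset.Icc 1 ((l.nodes + 1) + (r.nodes + 1)) \ A))).maximum =
      WithBot.some ((l.nodes + 1) + (r.nodes + 1)) ↔
      (l.nodes + 1) + (r.nodes + 1) ∉ A := by
    rw [List.maximum_eq_coe_iff, mem_map_relabel_right hA hv, and_iff_left,
      and_iff_right ⟨hpos, le_rfl⟩]
    exact fun a ha => (hw a (List.mem_append_right _ ha)).2
  simp only [admB, take_glue hu, drop_glue hu, admB_map (relabel_strictMono _),
    minimum_of_mem_permWords hg hpos, maximum_of_mem_permWords hg hpos, hmin, hmax,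
    Bool.and_eq_true, decide_eq_true_eq]
  tauto

theorem sum_admissible_evalBT_nd (l r : BT) :
    ∑ w ∈ (permWords ((l.nodes + 1) + (r.nodes + 1))).filter (fun w => admB (.nd l r) w = true),
      evalBT (R := R) (.nd l r) w =
    ∑ A ∈ splitSets (l.nodes + 1) (r.nodes + 1), brakW
      ((∑ u ∈ (permWords (l.nodes + 1)).filter (fun u => admB l u = true),
        evalBT l u).mapDomain (List.map (relabel A)))
      ((∑ v ∈ (permWords (r.nodes + 1)).filter (fun v => admB r v = true),
        evalBT r v).mapDomain
          (List.map (relabel (Finset.Icc 1 ((l.nodes + 1) + (r.nodes + 1)) \ A)))) := by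
  rw [Finset.sum_filter, sum_permWords_add, splitSets, Finset.sum_filter]
  refine Finset.sum_congr rfl fun A hA => ?_
  simp only [Finsupp.mapDomain_finsetSum, brakW_sum, ← evalBT_map]
  simp only [Finset.sum_filter]
  split_ifs with h
  · refine Finset.sum_congr rfl fun u hu => ?_
    split_ifs with hl
    · refine Finset.sum_congr rfl fun v hv => ?_
      simp only [admB_nd_glue hA hu hv, h, hl, evalBT, take_glue hu, drop_glue hu, true_and,
        not_false_eq_true]
    · exact Finset.sum_eq_zero fun v hv =>
        if_neg fun hc => hl ((admB_nd_glue hA hu hv).1 hc).2.1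
  · exact Finset.sum_eq_zero fun u hu => Finset.sum_eq_zero fun v hv =>
      if_neg fun hc => h ((admB_nd_glue hA hu hv).1 hc).1

theorem stmt10 : ∀ t : BT,
    EBT t = ∑ w ∈ (permWords (t.nodes + 1)).filter (fun w => admB t w = true),
      evalBT t w := by
  intro t
  induction t with
  | nil => simp [EBT, BT.nodes, permWords_one, admB, evalBT, Finset.filter_singleton]
  | nd l r ihl ihr =>
    rw [nodes_nd_add_one, sum_admissible_evalBT_nd, ← ihl, ← ihr, EBT,
      neExt_eq_sum (EBT_mem_supported l) (EBT_mem_supported r) (Nat.succ_pos _),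
      swExt_eq_sum (EBT_mem_supported l) (EBT_mem_supported r) (Nat.succ_pos _),
      ← Finset.sum_sub_distrib]
    rfl
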